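/- Fix n ≥ 4 and let X_n = {x_{ij} : 1 ≤ i < j ≤ n}. The Cayley–Menger ideal CM_n, i.e., the ideal of ℚ[X_n] generated by all 5×5 minors of the Cayley–Menger matrix on n points, is a prime ideal. -/

import Mathlib

noncomputable section

/-- The set of variables `X_n = {x_{ij} : 1 ≤ i < j ≤ n}`, realized as unordered
pairs of distinct elements of `Fin n`. -/
abbrev XVar (n : ℕ) : Type := {e : Sym2 (Fin n) // ¬ e.IsDiag}

/-- The Cayley–Menger matrix on `n` points: the `(n+1) × (n+1)` symmetric matrix with
rows and columns indexed by `0, 1, …, n`, with entry `0` at `(0,0)`, entries `1` at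
`(0,i)` and `(i,0)` for `i ≥ 1`, entries `0` on the diagonal, and variable `x_{ij}`
at positions `(i,j)` and `(j,i)` for distinct `i, j ≥ 1`. -/
def cmMatrix (n : ℕ) : Matrix (Fin (n + 1)) (Fin (n + 1)) (MvPolynomial (XVar n) ℚ) :=
  Matrix.of fun i j =>
    if hij : i = j then 0
    else if hi : i = 0 then 1
    else if hj : j = 0 then 1
    else MvPolynomial.X ⟨s(i.pred hi, j.pred hj), by
      rw [Sym2.mk_isDiag_iff]
      exact fun h => hij (by
        have := congrArg (Fin.succ) h
        rwa [Fin.succ_pred, Fin.succ_pred] at this)⟩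

/-- The Cayley–Menger ideal `CM_n ⊆ ℚ[X_n]`: the ideal generated by all `5 × 5`
minors of the Cayley–Menger matrix on `n` points. -/
def cmIdeal (n : ℕ) : Ideal (MvPolynomial (XVar n) ℚ) :=
  Ideal.span { p | ∃ (r c : Fin 5 → Fin (n + 1)),
    Function.Injective r ∧ Function.Injective c ∧
    p = ((cmMatrix n).submatrix r c).det }

open MvPolynomial

universe u v

theorem Multiset.filterMap_none {α β : Type*} (S : Multiset α) :
    S.filterMap (fun _ => (none : Option β)) = 0 :=
  Multiset.eq_zero_of_forall_notMem (by simp)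

section Segre

variable {ι κ K C : Type*} [CommRing K] [CommRing C] [Algebra K C]

/-- If `w` is a matrix whose `2 × 2` minors vanish, then a product of entries of `w` depends only
on the multisets of row and column indices involved. -/
theorem Multiset.prod_map_eq_of_rankOne {w : ι × κ → C}
    (hw : ∀ i j k l, w (i, j) * w (k, l) = w (i, l) * w (k, j)) (S T : Multiset (ι × κ))
    (h₁ : S.map Prod.fst = T.map Prod.fst) (h₂ : S.map Prod.snd = T.map Prod.snd) :
    (S.map w).prod = (T.map w).prod := by
  induction S using Multiset.induction generalizing T with
  | empty =>
    obtain rfl : T = 0 := by simpa using h₁.symm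
    rfl
  | cons p S ih =>
    obtain ⟨i, j⟩ := p
    obtain ⟨⟨_, l⟩, hl, rfl⟩ := Multiset.mem_map.1 (h₁ ▸ by simp : i ∈ T.map Prod.fst)
    obtain ⟨T, rfl⟩ := Multiset.exists_cons_of_mem hl
    simp only [Multiset.map_cons, Multiset.cons_inj_right, Multiset.prod_cons] at h₁ h₂ ⊢
    by_cases hjl : j = l
    · subst hjl
      rw [ih T h₁ ((Multiset.cons_inj_right _).1 h₂)]
    have hj : j ∈ T.map Prod.snd :=
      (Multiset.mem_cons.1 (h₂ ▸ Multiset.mem_cons_self j _)).resolve_left hjl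
    obtain ⟨⟨k, _⟩, hk, rfl⟩ := Multiset.mem_map.1 hj
    obtain ⟨T, rfl⟩ := Multiset.exists_cons_of_mem hk
    simp only [Multiset.map_cons, Multiset.prod_cons] at h₁ h₂ ⊢
    rw [Multiset.cons_swap, Multiset.cons_inj_right] at h₂
    rw [ih ((k, l) ::ₘ T) (by simpa using h₁) (by simpa using h₂)]
    simp only [Multiset.map_cons, Multiset.prod_cons, ← mul_assoc, hw]

/-- The relations among the products `x i * y j` are consequences of the vanishing of the
`2 × 2` minors of the matrix `(x i * y j)`. -/
theorem MvPolynomial.aeval_eq_zero_of_rankOne {w : ι × κ → C}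
    (hw : ∀ i j k l, w (i, j) * w (k, l) = w (i, l) * w (k, j)) (q : MvPolynomial (ι × κ) K)
    (hq : aeval (fun p : ι × κ => (X (Sum.inl p.1) * X (Sum.inr p.2) : MvPolynomial (ι ⊕ κ) K)) q
      = 0) :
    aeval w q = 0 := by
  let φ : MvPolynomial (ι × κ) K →ₐ[K] MvPolynomial (ι ⊕ κ) K :=
    aeval fun p => X (Sum.inl p.1) * X (Sum.inr p.2)
  change φ q = 0 at hq
  let marg : (ι × κ →₀ ℕ) → (ι ⊕ κ →₀ ℕ) := fun s =>
    s.mapDomain (Sum.inl ∘ Prod.fst) + s.mapDomain (Sum.inr ∘ Prod.snd)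
  let h : (ι × κ →₀ ℕ) → C := fun s => s.prod fun p e => w p ^ e
  have hfac : h.FactorsThrough marg := by
    intro s t hst
    have hh (u : ι × κ →₀ ℕ) : h u = (u.toMultiset.map w).prod := by
      rw [Finsupp.toMultiset_map, Finsupp.prod_toMultiset,
        Finsupp.prod_mapDomain_index (by simp) (fun _ _ _ => pow_add _ _ _)]
    have key := congrArg Finsupp.toMultiset hst
    simp only [marg, map_add, ← Finsupp.toMultiset_map] at key
    have hl := congrArg (Multiset.filterMap Sum.getLeft?) key
    have hr := congrArg (Multiset.filterMap Sum.getRight?) key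
    simp only [Multiset.filterMap_add, Multiset.filterMap_map, ← Function.comp_assoc] at hl hr
    rw [hh, hh]
    refine Multiset.prod_map_eq_of_rankOne hw _ _ ?_ ?_
    · simpa [Function.comp_def, ← Multiset.filterMap_eq_map, Multiset.filterMap_none] using hl
    · simpa [Function.comp_def, ← Multiset.filterMap_eq_map, Multiset.filterMap_none] using hr
  let L : MvPolynomial (ι ⊕ κ) K →ₗ[K] C :=
    (basisMonomials (ι ⊕ κ) K).constr K (Function.extend marg h 0)
  have hL : L ∘ₗ φ.toLinearMap = (aeval w).toLinearMap := by
    refine (basisMonomials (ι × κ) K).ext fun s => ?_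
    have hs : φ (monomial s 1) = basisMonomials (ι ⊕ κ) K (marg s) := by
      simp only [φ, coe_basisMonomials, monomial_eq (s := marg s), marg]
      rw [Finsupp.prod_add_index' (by simp)
        (fun _ _ _ => pow_add _ _ _), Finsupp.prod_mapDomain_index (by simp)
        (fun _ _ _ => pow_add _ _ _), Finsupp.prod_mapDomain_index (by simp)
        (fun _ _ _ => pow_add _ _ _), ← Finsupp.prod_mul]
      simp only [aeval_monomial, map_one, one_mul, mul_pow, Function.comp_apply]
    rw [LinearMap.comp_apply, coe_basisMonomials, AlgHom.toLinearMap_apply,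
      AlgHom.toLinearMap_apply]
    refine (congrArg L hs).trans ?_
    rw [Module.Basis.constr_basis, hfac.extend_apply]
    simp [h, aeval_monomial]
  have := LinearMap.congr_fun hL q
  rw [LinearMap.comp_apply, AlgHom.toLinearMap_apply, hq, map_zero] at this
  exact this.symm

end Segre

section SymmetricMinors

variable {ι B : Type*} [CommRing B]

/-- The `2 × 2` minor, up to sign, of `z` with rows `p` and columns `q`. -/
def Matrix.minorTwo (z : Matrix ι ι B) (p q : ι × ι) : B :=
  z p.1 q.2 * z p.2 q.1 - z p.1 q.1 * z p.2 q.2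

theorem Matrix.minorTwo_cyclic {z : Matrix ι ι B}
    (hz : ∀ r c : Fin 3 → ι, (z.submatrix r c).det = 0) (i j k l : ι) (q : ι × ι) :
    z i l * z.minorTwo (j, k) q + z j l * z.minorTwo (k, i) q + z k l * z.minorTwo (i, j) q = 0 := by
  have := hz ![i, j, k] ![l, q.1, q.2]
  simp only [Matrix.det_fin_three, Matrix.submatrix_apply, Matrix.cons_val] at this
  simp only [Matrix.minorTwo]
  linear_combination -this

theorem Matrix.minorTwo_symm {z : Matrix ι ι B} (hs : z.IsSymm) (p q : ι × ι) :
    z.minorTwo p q = z.minorTwo q p := by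
  simp only [Matrix.minorTwo, hs.apply p.1, hs.apply p.2]
  ring

theorem Matrix.minorTwo_mul_minorTwo {z : Matrix ι ι B}
    (hz : ∀ r c : Fin 3 → ι, (z.submatrix r c).det = 0) (p q r s : ι × ι) :
    z.minorTwo p q * z.minorTwo r s = z.minorTwo p s * z.minorTwo r q := by
  have key (a b c d : ι) (q s : ι × ι) : z.minorTwo (a, b) q * z.minorTwo (c, d) s =
      z.minorTwo (a, c) q * z.minorTwo (b, d) s - z.minorTwo (a, d) q * z.minorTwo (b, c) s := by
    have h₁ := Matrix.minorTwo_cyclic hz b c d q.1 s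
    have h₂ := Matrix.minorTwo_cyclic hz b c d q.2 s
    simp only [Matrix.minorTwo] at *
    linear_combination z a q.2 * h₁ - z a q.1 * h₂
  obtain ⟨a, b⟩ := p
  obtain ⟨c, d⟩ := r
  have h₁ := key a c b d q s
  have h₂ := key b d a c s q
  simp only [Matrix.minorTwo] at *
  linear_combination h₂ - h₁

/-- The submodule `B × M` of `B × (ι × ι → B)`, where `M` is spanned by the rows of the matrix of
`2 × 2` minors of `z`. -/
def Matrix.minorExt (z : Matrix ι ι B) : Submodule B (B × (ι × ι → B)) :=
  Submodule.prod ⊤ (Submodule.span B (Set.range z.minorTwo))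

/-- The endomorphism `(a, m) ↦ (z p * a + m p, z p • m + a • minorTwo z p)` of `B × M`. Together
these endomorphisms form a matrix with vanishing `2 × 2` minors when `z` is symmetric with
vanishing `3 × 3` minors. -/
def Matrix.minorExtEnd (z : Matrix ι ι B) (p : ι × ι) : Module.End B z.minorExt :=
  LinearMap.restrict (p := z.minorExt) (q := z.minorExt)
    (z p.1 p.2 • LinearMap.id + LinearMap.prod
      (LinearMap.proj p ∘ₗ LinearMap.snd B B (ι × ι → B))
      (LinearMap.toSpanSingleton B _ (z.minorTwo p) ∘ₗ LinearMap.fst B B (ι × ι → B)))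
    fun x hx => ⟨Submodule.mem_top, by
      exact Submodule.add_mem _ (Submodule.smul_mem _ _ hx.2)
        (Submodule.smul_mem _ _ (Submodule.subset_span ⟨p, rfl⟩))⟩

theorem Matrix.minorExtEnd_fst (z : Matrix ι ι B) (p : ι × ι) (x : z.minorExt) :
    (z.minorExtEnd p x).1.1 = z p.1 p.2 * x.1.1 + x.1.2 p := rfl

theorem Matrix.minorExtEnd_snd (z : Matrix ι ι B) (p q : ι × ι) (x : z.minorExt) :
    (z.minorExtEnd p x).1.2 q = z p.1 p.2 * x.1.2 q + x.1.1 * z.minorTwo p q := rfl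

theorem Matrix.minorExt_snd_eq_zero {z : Matrix ι ι B} (x : z.minorExt)
    (f : (ι × ι → B) →ₗ[B] B) (hf : ∀ r, f (z.minorTwo r) = 0) : f x.1.2 = 0 :=
  (Submodule.span_le (p := LinearMap.ker f)).2 (by rintro _ ⟨r, rfl⟩; exact hf r) x.2.2

theorem Matrix.minorExt_snd_cyclic {z : Matrix ι ι B} (hs : z.IsSymm)
    (hz : ∀ r c : Fin 3 → ι, (z.submatrix r c).det = 0) (x : z.minorExt) (i j k l : ι) :
    z i l * x.1.2 (j, k) + z j l * x.1.2 (k, i) + z k l * x.1.2 (i, j) = 0 :=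
  minorExt_snd_eq_zero x
    (z i l • LinearMap.proj (R := B) (φ := fun _ => B) (j, k) +
      z j l • LinearMap.proj (R := B) (φ := fun _ => B) (k, i) +
      z k l • LinearMap.proj (R := B) (φ := fun _ => B) (i, j)) fun r => by
      simpa [z.minorTwo_symm hs r] using minorTwo_cyclic hz i j k l r

theorem Matrix.minorExt_snd_swap {z : Matrix ι ι B} (x : z.minorExt) (i j : ι) :
    x.1.2 (i, j) + x.1.2 (j, i) = 0 := by
  simpa using minorExt_snd_eq_zero x
    (LinearMap.proj (R := B) (φ := fun _ => B) (i, j) +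
      LinearMap.proj (R := B) (φ := fun _ => B) (j, i)) fun r => by
        simp only [minorTwo, LinearMap.add_apply, LinearMap.proj_apply]
        ring

theorem Matrix.minorExt_snd_mul_minorTwo {z : Matrix ι ι B}
    (hz : ∀ r c : Fin 3 → ι, (z.submatrix r c).det = 0) (x : z.minorExt) (p q r : ι × ι) :
    x.1.2 q * z.minorTwo p r = x.1.2 r * z.minorTwo p q := by
  simpa [sub_eq_zero, mul_comm] using minorExt_snd_eq_zero x
    (z.minorTwo p r • LinearMap.proj (R := B) (φ := fun _ => B) q -
      z.minorTwo p q • LinearMap.proj (R := B) (φ := fun _ => B) r) fun s => by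
      simpa [sub_eq_zero, mul_comm] using z.minorTwo_mul_minorTwo hz p r s q

theorem Matrix.minorExt_ext {z : Matrix ι ι B} {x y : z.minorExt} (h₁ : x.1.1 = y.1.1)
    (h₂ : ∀ r, x.1.2 r = y.1.2 r) : x = y :=
  Subtype.ext (Prod.ext h₁ (funext h₂))

theorem Matrix.minorExtEnd_comm {z : Matrix ι ι B} (hs : z.IsSymm)
    (hz : ∀ r c : Fin 3 → ι, (z.submatrix r c).det = 0) (p q : ι × ι) :
    z.minorExtEnd p * z.minorExtEnd q = z.minorExtEnd q * z.minorExtEnd p := by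
  ext x : 1
  refine minorExt_ext ?_ fun r => ?_
  · simp only [Module.End.mul_apply, minorExtEnd_fst, minorExtEnd_snd]
    linear_combination x.1.1 * z.minorTwo_symm hs q p
  · simp only [Module.End.mul_apply, minorExtEnd_fst, minorExtEnd_snd]
    linear_combination minorExt_snd_mul_minorTwo hz x p q r -
      minorExt_snd_mul_minorTwo hz x q p r + x.1.2 r * z.minorTwo_symm hs p q

theorem Matrix.minorExtEnd_rankOne {z : Matrix ι ι B} (hs : z.IsSymm)
    (hz : ∀ r c : Fin 3 → ι, (z.submatrix r c).det = 0) (i j k l : ι) :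
    z.minorExtEnd (i, j) * z.minorExtEnd (k, l) = z.minorExtEnd (i, l) * z.minorExtEnd (k, j) := by
  have hm : z i j * z k l + z.minorTwo (i, j) (k, l) =
      z i l * z k j + z.minorTwo (i, l) (k, j) := by
    simp only [minorTwo]
    linear_combination -z i j * hs.apply k l + z i l * hs.apply k j + z i k * hs.apply j l
  have hO (x : z.minorExt) : z i j * x.1.2 (k, l) + z k l * x.1.2 (i, j) =
      z i l * x.1.2 (k, j) + z k j * x.1.2 (i, l) := by
    have h₁ := minorExt_snd_cyclic hs hz x j k l i
    have h₂ := minorExt_snd_cyclic hs hz x i j l k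
    rw [hs.apply i j, hs.apply i k, hs.apply i l] at h₁
    rw [hs.apply k j, hs.apply k l] at h₂
    linear_combination h₁ + h₂ - z i k * minorExt_snd_swap x j l -
      z i l * minorExt_snd_swap x j k - z k j * minorExt_snd_swap x l i
  have hOm (r : ι × ι) : z i j * z.minorTwo (k, l) r + z k l * z.minorTwo (i, j) r =
      z i l * z.minorTwo (k, j) r + z k j * z.minorTwo (i, l) r := by
    simpa only [z.minorTwo_symm hs r] using
      hO ⟨(0, z.minorTwo r), Submodule.mem_top, Submodule.subset_span ⟨r, rfl⟩⟩
  ext x : 1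
  refine minorExt_ext ?_ fun r => ?_
  · simp only [Module.End.mul_apply, minorExtEnd_fst, minorExtEnd_snd]
    linear_combination x.1.1 * hm + hO x + x.1.1 * z.minorTwo_symm hs (k, l) (i, j) -
      x.1.1 * z.minorTwo_symm hs (k, j) (i, l)
  · simp only [Module.End.mul_apply, minorExtEnd_fst, minorExtEnd_snd]
    linear_combination x.1.1 * hOm r + x.1.2 r * hm +
      minorExt_snd_mul_minorTwo hz x (i, j) (k, l) r -
      minorExt_snd_mul_minorTwo hz x (i, l) (k, j) r

open scoped IsMulCommutative in
/-- Pairwise commuting elements of an algebra lie in a commutative subalgebra. -/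
theorem Algebra.exists_commRing_of_commute {κ B : Type*} {A : Type u} [CommRing B]
    [Ring A] [Algebra B A] (e : κ → A) (he : ∀ p q, e p * e q = e q * e p) :
    ∃ (C : Type u) (_ : CommRing C) (_ : Algebra B C) (f : C →ₐ[B] A) (w : κ → C),
      Function.Injective f ∧ ∀ p, f (w p) = e p := by
  have := Algebra.isMulCommutative_adjoin B (s := Set.range e) (by
    rintro _ ⟨p, rfl⟩ _ ⟨q, rfl⟩
    exact he p q)
  exact ⟨Algebra.adjoin B (Set.range e), inferInstance, inferInstance, Subalgebra.val _,
    fun p => ⟨e p, Algebra.subset_adjoin ⟨p, rfl⟩⟩, Subtype.val_injective, fun _ => rfl⟩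

/-- A symmetric matrix whose `3 × 3` minors vanish is, after an extension of the base ring, the
symmetrization of a matrix whose `2 × 2` minors vanish. -/
theorem Matrix.exists_rankOne_symmetrization {ι : Type u} {B : Type v} [CommRing B]
    {z : Matrix ι ι B} (hs : z.IsSymm) (hz : ∀ r c : Fin 3 → ι, (z.submatrix r c).det = 0) :
    ∃ (C : Type (max u v)) (_ : CommRing C) (_ : Algebra B C) (w : ι × ι → C),
      Function.Injective (algebraMap B C) ∧
      (∀ i j k l, w (i, j) * w (k, l) = w (i, l) * w (k, j)) ∧
      ∀ i j, w (i, j) + w (j, i) = algebraMap B C (2 * z i j) := by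
  obtain ⟨C, _, _, f, w, hf, hw⟩ :=
    Algebra.exists_commRing_of_commute (B := B) z.minorExtEnd (minorExtEnd_comm hs hz)
  refine ⟨C, inferInstance, inferInstance, w, fun a b hab => ?_, fun i j k l => hf ?_,
    fun i j => hf (LinearMap.ext fun x => ?_)⟩
  · have := congrArg (fun c => (f c (⟨(1, 0), by simp [minorExt]⟩ : z.minorExt)).1.1) hab
    simpa using this
  · simpa [hw] using minorExtEnd_rankOne hs hz i j k l
  · rw [map_add, hw, hw, AlgHom.commutes]
    refine minorExt_ext ?_ fun r => ?_
    · change (z.minorExtEnd (i, j) x).1.1 + (z.minorExtEnd (j, i) x).1.1 = 2 * z i j * x.1.1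
      simp only [minorExtEnd_fst]
      linear_combination minorExt_snd_swap x i j + x.1.1 * hs.apply i j
    · change (z.minorExtEnd (i, j) x).1.2 r + (z.minorExtEnd (j, i) x).1.2 r =
        2 * z i j * x.1.2 r
      simp only [minorExtEnd_snd, minorTwo]
      linear_combination x.1.2 r * hs.apply i j

/-- The relations among the polynomials `x i * y j + x j * y i` are consequences of the vanishing
of the `3 × 3` minors of the symmetric matrix formed by them. -/
theorem Matrix.aeval_two_mul_eq_zero {ι B K : Type*} [CommRing K] [CommRing B] [Algebra K B]
    {z : Matrix ι ι B} (hs : z.IsSymm)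
    (hz : ∀ r c : Fin 3 → ι, (z.submatrix r c).det = 0)
    (q : MvPolynomial (ι × ι) K)
    (hq : aeval (fun p : ι × ι => (X (Sum.inl p.1) * X (Sum.inr p.2) +
      X (Sum.inl p.2) * X (Sum.inr p.1) : MvPolynomial (ι ⊕ ι) K)) q = 0) :
    aeval (fun p : ι × ι => 2 * z p.1 p.2) q = 0 := by
  obtain ⟨C, _, _, w, hinj, hw, hwz⟩ := exists_rankOne_symmetrization hs hz
  let _ : Algebra K C := Algebra.compHom C (algebraMap K B)
  have : IsScalarTower K B C := .of_algebraMap_eq' rfl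
  apply hinj
  have key := aeval_eq_zero_of_rankOne hw
    (aeval (fun p : ι × ι => (X p + X p.swap : MvPolynomial (ι × ι) K)) q)
    (by rw [← AlgHom.comp_apply, comp_aeval]; simpa using hq)
  rw [← AlgHom.comp_apply, comp_aeval] at key
  rw [map_zero, ← aeval_algebraMap_apply, ← key]
  congr 2
  ext p
  simpa [Prod.swap] using (hwz p.1 p.2).symm

end SymmetricMinors

/-- A bordered `5 × 5` determinant of Cayley–Menger shape as a `3 × 3` Gram determinant. -/
theorem Matrix.det_bordered {R : Type*} [CommRing R] (b c : Fin 3 → R)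
    (d : Matrix (Fin 3) (Fin 3) R) :
    !![0, 1, 1, 1, 1; 1, 0, c 0, c 1, c 2; 1, b 0, d 0 0, d 0 1, d 0 2;
      1, b 1, d 1 0, d 1 1, d 1 2; 1, b 2, d 2 0, d 2 1, d 2 2].det =
    (Matrix.of fun i j => b i + c j - d i j).det := by
  simp only [Matrix.det_succ_row_zero (n := 4), Matrix.det_succ_row_zero (n := 3),
    Fin.sum_univ_succ, Matrix.det_fin_three, Matrix.of_apply, Matrix.submatrix_apply,
    Fin.succAbove]
  simp
  ring

section CayleyMenger

variable {n : ℕ}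

theorem cmMatrix_succ_succ {i j : Fin n} (h : ¬ (s(i, j)).IsDiag) :
    cmMatrix n i.succ j.succ = X ⟨s(i, j), h⟩ := by
  have hij : i ≠ j := by simpa using h
  simp [cmMatrix, hij]

theorem cmMatrix_self (i : Fin (n + 1)) : cmMatrix n i i = 0 := by
  simp [cmMatrix]

theorem cmMatrix_zero_succ (i : Fin n) : cmMatrix n 0 i.succ = 1 := by
  simp [cmMatrix, (Fin.succ_ne_zero i).symm]

theorem cmMatrix_succ_zero (i : Fin n) : cmMatrix n i.succ 0 = 1 := by
  simp [cmMatrix]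

theorem cmMatrix_comm (i j : Fin (n + 1)) : cmMatrix n i j = cmMatrix n j i := by
  by_cases hij : i = j
  · rw [hij]
  by_cases hi : i = 0
  · subst hi
    simp [cmMatrix, hij, Ne.symm hij]
  by_cases hj : j = 0
  · subst hj
    simp [cmMatrix, hij, Ne.symm hij]
  simp [cmMatrix, hij, Ne.symm hij, hi, hj, Sym2.eq_swap]

theorem det_submatrix_cmMatrix_mem_cmIdeal (r c : Fin 5 → Fin (n + 1)) :
    ((cmMatrix n).submatrix r c).det ∈ cmIdeal n := by
  by_cases hr : Function.Injective r
  · by_cases hc : Function.Injective c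
    · exact Ideal.subset_span ⟨r, c, hr, hc, rfl⟩
    · obtain ⟨i, j, h, hij⟩ := Function.not_injective_iff.1 hc
      rw [Matrix.det_zero_of_column_eq hij (by simp [h])]
      exact zero_mem _
  · obtain ⟨i, j, h, hij⟩ := Function.not_injective_iff.1 hr
    rw [Matrix.det_zero_of_row_eq hij (by ext; simp [h])]
    exact zero_mem _

/-- The Gram matrix of the points with respect to the base point `o`, multiplied by `2`. -/
def cmGram (o : Fin n) : Matrix (Fin n) (Fin n) (MvPolynomial (XVar n) ℚ) :=
  Matrix.of fun i j =>
    cmMatrix n o.succ i.succ + cmMatrix n o.succ j.succ - cmMatrix n i.succ j.succ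

theorem det_submatrix_cmGram_mem_cmIdeal (o : Fin n) (r c : Fin 3 → Fin n) :
    ((cmGram o).submatrix r c).det ∈ cmIdeal n := by
  have key := det_submatrix_cmMatrix_mem_cmIdeal
    ![0, o.succ, (r 0).succ, (r 1).succ, (r 2).succ]
    ![0, o.succ, (c 0).succ, (c 1).succ, (c 2).succ]
  convert key using 1
  have h := Matrix.det_bordered (fun i => cmMatrix n (r i).succ o.succ)
    (fun j => cmMatrix n o.succ (c j).succ) fun i j => cmMatrix n (r i).succ (c j).succ
  convert h.symm using 2
  · ext1 i j
    simp [cmGram, cmMatrix_comm (r i).succ o.succ]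
  · ext1 i j
    fin_cases i <;> fin_cases j <;>
      simp [cmMatrix_self, cmMatrix_zero_succ, cmMatrix_succ_zero]

/-- The coordinates of a generic configuration of `n` points in the plane equipped with the
quadratic form `x * y`. -/
def cmParam (n : ℕ) : MvPolynomial (XVar n) ℚ →ₐ[ℚ] MvPolynomial (Fin n ⊕ Fin n) ℚ :=
  aeval fun e => Sym2.lift ⟨fun i j =>
    (X (Sum.inl i) - X (Sum.inl j)) * (X (Sum.inr i) - X (Sum.inr j)), fun i j => by ring⟩ e.1

theorem cmParam_cmMatrix (i j : Fin n) : cmParam n (cmMatrix n i.succ j.succ) =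
    (X (Sum.inl i) - X (Sum.inl j)) * (X (Sum.inr i) - X (Sum.inr j)) := by
  by_cases hij : i = j
  · simp [hij, cmMatrix_self]
  · rw [cmMatrix_succ_succ (by simpa using hij)]
    simp [cmParam]

theorem cmIdeal_le_ker_cmParam : cmIdeal n ≤ RingHom.ker (cmParam n) := by
  refine Ideal.span_le.2 ?_
  rintro _ ⟨r, c, -, -, rfl⟩
  let U : Matrix (Fin (n + 1)) (Fin 5) (MvPolynomial (Fin n ⊕ Fin n) ℚ) :=
    Fin.cons ![1, 0, 0, 0, 0] fun i =>
      ![X (Sum.inl i) * X (Sum.inr i), 1, -X (Sum.inl i), -X (Sum.inr i), 0]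
  let V : Matrix (Fin (n + 1)) (Fin 5) (MvPolynomial (Fin n ⊕ Fin n) ℚ) :=
    Fin.cons ![0, 1, 0, 0, 0] fun j =>
      ![1, X (Sum.inl j) * X (Sum.inr j), X (Sum.inr j), X (Sum.inl j), 0]
  have hUV : (cmMatrix n).map (cmParam n) = U * V.transpose := by
    ext1 i j
    simp only [Matrix.mul_apply, Matrix.map_apply, Matrix.transpose_apply]
    refine Fin.cases ?_ (fun i => ?_) i <;> refine Fin.cases ?_ (fun j => ?_) j
    · simp [U, V, Fin.sum_univ_five, cmMatrix_self]
    · simp [U, V, Fin.sum_univ_five, cmMatrix_zero_succ]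
    · simp [U, V, Fin.sum_univ_five, cmMatrix_succ_zero]
    · simp [U, V, Fin.sum_univ_five, cmParam_cmMatrix]
      ring
  change cmParam n _ = 0
  rw [AlgHom.map_det, AlgHom.mapMatrix_apply, ← Matrix.submatrix_map, hUV,
    Matrix.submatrix_mul _ _ r id c Function.bijective_id, Matrix.det_mul,
    Matrix.det_eq_zero_of_column_eq_zero 4, zero_mul]
  intro i
  rw [Matrix.submatrix_apply]
  refine Fin.cases ?_ (fun i => ?_) (r i) <;> simp [U]

theorem ker_cmParam_le_cmIdeal (o : Fin n) : RingHom.ker (cmParam n) ≤ cmIdeal n := by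
  intro f hf
  rw [RingHom.mem_ker] at hf
  let π := Ideal.Quotient.mkₐ ℚ (cmIdeal n)
  let z : Matrix (Fin n) (Fin n) (MvPolynomial (XVar n) ℚ ⧸ cmIdeal n) :=
    (1 / 2 : ℚ) • (cmGram o).map π
  have hs : z.IsSymm := by
    ext1 i j
    simp only [z, cmGram, Matrix.transpose_apply, Matrix.smul_apply, Matrix.map_apply,
      Matrix.of_apply, cmMatrix_comm j.succ i.succ]
    rw [add_comm (cmMatrix n o.succ j.succ)]
  have hz (r c : Fin 3 → Fin n) : (z.submatrix r c).det = 0 := by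
    have h := det_submatrix_cmGram_mem_cmIdeal o r c
    rw [← Ideal.Quotient.eq_zero_iff_mem] at h
    change π _ = 0 at h
    rw [AlgHom.map_det, AlgHom.mapMatrix_apply, ← Matrix.submatrix_map] at h
    rw [Matrix.submatrix_smul, Pi.smul_apply, Pi.smul_apply, Matrix.det_smul_of_tower, h, smul_zero]
  let σ : MvPolynomial (XVar n) ℚ →ₐ[ℚ] MvPolynomial (Fin n × Fin n) ℚ :=
    aeval fun e => Sym2.lift ⟨fun i j =>
      (1 / 2 : ℚ) • (X (i, i) + X (j, j) - X (i, j) - X (j, i)),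
      fun i j => congrArg _ (by ring)⟩ e.1
  have h₀ := Matrix.aeval_two_mul_eq_zero (K := ℚ) hs hz (σ f) (by
    rw [← hf, ← AlgHom.comp_apply]
    congr 1
    ext1 ⟨e, he⟩
    induction e using Sym2.ind with | _ i j => ?_
    simp only [σ, cmParam, AlgHom.comp_apply, aeval_X, Sym2.lift_mk, map_smul, map_sub, map_add]
    rw [one_div, inv_smul_eq_iff₀ two_ne_zero, two_smul]
    ring)
  have hz₂ : (fun p : Fin n × Fin n => 2 * z p.1 p.2) = fun p => π (cmGram o p.1 p.2) := by
    ext1 p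
    change 2 * ((1 / 2 : ℚ) • π (cmGram o p.1 p.2)) = _
    rw [two_mul, ← add_smul, add_halves, one_smul]
  rw [hz₂, ← AlgHom.comp_apply] at h₀
  rw [← Ideal.Quotient.eq_zero_iff_mem, ← h₀]
  change π f = _
  congr 1
  ext1 ⟨e, he⟩
  induction e using Sym2.ind with | _ i j => ?_
  simp only [σ, AlgHom.comp_apply, aeval_X, Sym2.lift_mk, map_smul, map_sub, map_add]
  rw [eq_comm, one_div, inv_smul_eq_iff₀ two_ne_zero, two_smul, ← cmMatrix_succ_succ he]
  simp only [← map_sub, ← map_add, cmGram, Matrix.of_apply, cmMatrix_self,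
    cmMatrix_comm j.succ i.succ]
  congr 1
  ring

end CayleyMenger

/-- The Cayley–Menger ideal is prime. -/
theorem cmIdeal_isPrime (n : ℕ) (hn : 4 ≤ n) : (cmIdeal n).IsPrime := by
  rw [le_antisymm cmIdeal_le_ker_cmParam (ker_cmParam_le_cmIdeal ⟨0, by lia⟩)]
  exact RingHom.ker_isPrime _

end
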